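/- arXiv:2409.02557 — 2 statements merged into one kernel-verified Lean document; each statement's English description precedes it below -/
import Mathlib

section
/- Let V be a complex vector space, B : V × V → ℂ a symmetric bilinear form, and define the reduced ternary commutator ⟦x,y,z⟧ = B(z,x)·y + ω·B(x,y)·z + ω̄·B(y,z)·x. Then for all x, y, z, u, v in V the reduced identity holds: the sum over the five cyclic shifts of (x,y,z,u,v) of ⟦⟦x,y,z⟧,u,v⟧, plus the sum over the five cyclic shifts of (x,y,z,u,v) of ⟦⟦x,u,y⟧,v,z⟧, equals zero. -/
/-- The primitive cube root of unity `ω = exp(2πi/3)`. -/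
noncomputable def ω : ℂ := Complex.exp (2 * Real.pi * Complex.I / 3)

/-- Its complex conjugate `ω̄`. -/
noncomputable def ωb : ℂ := (starRingEnd ℂ) ω

/-- The reduced ternary commutator `⟦x,y,z⟧ = B(z,x) y + ω B(x,y) z + ω̄ B(y,z) x`
built from a bilinear form `B`. -/
noncomputable def rtc {V : Type*} [AddCommGroup V] [Module ℂ V]
    (B : V →ₗ[ℂ] V →ₗ[ℂ] ℂ) (x y z : V) : V :=
  B z x • y + ω • (B x y • z) + ωb • (B y z • x)

theorem one_add_ω_add_ω_sq : 1 + ω + ω ^ 2 = 0 := by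
  have h : IsPrimitiveRoot ω 3 := by
    simpa [ω] using Complex.isPrimitiveRoot_exp 3 (by norm_num)
  simpa [Finset.sum_range_succ] using h.geom_sum_eq_zero (by norm_num)

theorem ωb_eq_ω_sq : ωb = ω ^ 2 := by
  have h : ω ≠ 0 := Complex.exp_ne_zero _
  have hnorm : ω * ωb = 1 := by
    rw [ωb, Complex.mul_conj, Complex.normSq_eq_norm_sq, ω, Complex.norm_exp]
    simp
  apply mul_left_cancel₀ h
  linear_combination hnorm - (ω - 1) * one_add_ω_add_ω_sq

/-- A nested reduced ternary commutator, with the powers of `ω` reduced to degree at most one. -/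
theorem rtc_rtc {V : Type*} [AddCommGroup V] [Module ℂ V]
    (B : V →ₗ[ℂ] V →ₗ[ℂ] ℂ) (x y z u v : V) :
    rtc B (rtc B x y z) u v =
      (B z x * B v y + ω * (B x y * B v z) - (1 + ω) * (B y z * B v x)) • u
      + (ω * (B z x * B y u) - (1 + ω) * (B x y * B z u) + B y z * B x u) • v
      + B u v • ((-(1 + ω) * B z x) • y + B x y • z + (ω * B y z) • x) := by
  have h := one_add_ω_add_ω_sq
  simp only [rtc, ωb_eq_ω_sq, map_add, map_smul, LinearMap.add_apply, LinearMap.smul_apply,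
    smul_eq_mul]
  match_scalars
  · linear_combination (B y z * B v x) * h
  · linear_combination (B x y * B z u + (ω - 1) * (B y z * B x u)) * h
  · linear_combination (B u v * B z x) * h
  · linear_combination ((ω - 1) * (B u v * B x y)) * h
  · linear_combination ((ω ^ 2 - ω) * (B u v * B y z)) * h

/-- the reduced ternary commutator of a symmetric bilinear form
satisfies the reduced identity with ten terms. -/
theorem reduced_identity {V : Type*} [AddCommGroup V] [Module ℂ V]
    (B : V →ₗ[ℂ] V →ₗ[ℂ] ℂ) (hB : ∀ x y : V, B x y = B y x) :
    ∀ x y z u v : V,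
      (rtc B (rtc B x y z) u v + rtc B (rtc B y z u) v x + rtc B (rtc B z u v) x y
        + rtc B (rtc B u v x) y z + rtc B (rtc B v x y) z u)
      + (rtc B (rtc B x u y) v z + rtc B (rtc B y v z) x u + rtc B (rtc B z x u) y v
        + rtc B (rtc B u y v) z x + rtc B (rtc B v z x) u y) = 0 := by
  intro x y z u v
  simp only [rtc_rtc, hB y x, hB z x, hB u x, hB v x, hB z y, hB u y, hB v y, hB u z, hB v z,
    hB v u]
  module
end

section
/- On the complex vector space Mₙ(ℂ) of n×n complex matrices, the ternary bracket [Φ,Ψ,Ω] = Tr(ΩΦ)·Ψ + ω·Tr(ΦΨ)·Ω + ω̄·Tr(ΨΩ)·Φ satisfies the cyclic ω-symmetry [Φ,Ψ,Ω] = ω·[Ψ,Ω,Φ] = ω̄·[Ω,Φ,Ψ] and the reduced identity: the sum over the five cyclic shifts of (Φ₁,Φ₂,Φ₃,Φ₄,Φ₅) of [[Φ₁,Φ₂,Φ₃],Φ₄,Φ₅], plus the sum over the five cyclic shifts of [[Φ₁,Φ₄,Φ₂],Φ₅,Φ₃], equals zero, for all Φ₁,…,Φ₅ in Mₙ(ℂ).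 -/
/-- The ternary bracket `[Φ,Ψ,Ω] = Tr(ΩΦ) Ψ + ω Tr(ΦΨ) Ω + ω̄ Tr(ΨΩ) Φ` on `Mₙ(ℂ)`. -/
noncomputable def trBracket {n : ℕ} (Φ Ψ Ω : Matrix (Fin n) (Fin n) ℂ) :
    Matrix (Fin n) (Fin n) ℂ :=
  (Ω * Φ).trace • Ψ + ω • ((Φ * Ψ).trace • Ω) + ωb • ((Ψ * Ω).trace • Φ)

theorem isPrimitiveRoot_omega : IsPrimitiveRoot ω 3 := by
  simpa [ω] using Complex.isPrimitiveRoot_exp 3 (by norm_num)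

theorem omega_sq_add_omega_add_one : ω ^ 2 + ω + 1 = 0 := by
  have hs := isPrimitiveRoot_omega.geom_sum_eq_zero (by norm_num)
  simp only [Finset.sum_range_succ, Finset.sum_range_zero] at hs
  linear_combination hs

theorem omega_mul_omegab : ω * ωb = 1 := by
  rw [ωb, Complex.mul_conj, Complex.normSq_eq_norm_sq,
    isPrimitiveRoot_omega.norm'_eq_one (by norm_num)]
  norm_num

theorem omegab_eq : ωb = -1 - ω := by
  linear_combination ωb * omega_sq_add_omega_add_one - (ω + 1) * omega_mul_omegab

/-- on `Mₙ(ℂ)` the trace ternary bracket has the cyclic ω-symmetry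
`[Φ,Ψ,Ω] = ω [Ψ,Ω,Φ] = ω̄ [Ω,Φ,Ψ]` and satisfies the reduced (ten term) identity. -/
theorem trBracket_omega_symmetry_and_reduced_identity {n : ℕ} :
    (∀ Φ Ψ Ω : Matrix (Fin n) (Fin n) ℂ,
      trBracket Φ Ψ Ω = ω • trBracket Ψ Ω Φ ∧
      trBracket Φ Ψ Ω = ωb • trBracket Ω Φ Ψ) ∧
    (∀ Φ₁ Φ₂ Φ₃ Φ₄ Φ₅ : Matrix (Fin n) (Fin n) ℂ,
      (trBracket (trBracket Φ₁ Φ₂ Φ₃) Φ₄ Φ₅ + trBracket (trBracket Φ₂ Φ₃ Φ₄) Φ₅ Φ₁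
        + trBracket (trBracket Φ₃ Φ₄ Φ₅) Φ₁ Φ₂ + trBracket (trBracket Φ₄ Φ₅ Φ₁) Φ₂ Φ₃
        + trBracket (trBracket Φ₅ Φ₁ Φ₂) Φ₃ Φ₄)
      + (trBracket (trBracket Φ₁ Φ₄ Φ₂) Φ₅ Φ₃ + trBracket (trBracket Φ₂ Φ₅ Φ₃) Φ₁ Φ₄
        + trBracket (trBracket Φ₃ Φ₁ Φ₄) Φ₂ Φ₅ + trBracket (trBracket Φ₄ Φ₂ Φ₅) Φ₃ Φ₁
        + trBracket (trBracket Φ₅ Φ₃ Φ₁) Φ₄ Φ₂) = 0) := by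
  refine ⟨fun Φ Ψ Ω ↦ ⟨?_, ?_⟩, fun Φ₁ Φ₂ Φ₃ Φ₄ Φ₅ ↦ ?_⟩
  · simp only [trBracket, omegab_eq]
    match_scalars
    · linear_combination (Ω * Φ).trace * omega_sq_add_omega_add_one
    · ring
    · linear_combination -(Ψ * Ω).trace * omega_sq_add_omega_add_one
  · simp only [trBracket, omegab_eq]
    match_scalars
    · linear_combination (Ω * Φ).trace * omega_sq_add_omega_add_one
    · linear_combination -(Φ * Ψ).trace * omega_sq_add_omega_add_one
    · ring
  · simp only [trBracket, omegab_eq, add_mul, mul_add, Matrix.trace_add, smul_mul_assoc,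
      mul_smul_comm, Matrix.trace_smul, smul_eq_mul]
    rw [Matrix.trace_mul_comm Φ₂ Φ₁, Matrix.trace_mul_comm Φ₃ Φ₁, Matrix.trace_mul_comm Φ₄ Φ₁,
      Matrix.trace_mul_comm Φ₅ Φ₁, Matrix.trace_mul_comm Φ₃ Φ₂, Matrix.trace_mul_comm Φ₄ Φ₂,
      Matrix.trace_mul_comm Φ₅ Φ₂, Matrix.trace_mul_comm Φ₄ Φ₃, Matrix.trace_mul_comm Φ₅ Φ₃,
      Matrix.trace_mul_comm Φ₅ Φ₄]
    have h : ω ^ 2 = -1 - ω := by linear_combination omega_sq_add_omega_add_one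
    match_scalars
    all_goals
      ring_nf
      simp only [h]
      ring
end
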